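/- arXiv:2108.11030 — 2 statements merged into one kernel-verified Lean document; each statement's English description precedes it below -/
import Mathlib

section
/- For every integer n ≥ 2 and every ε ∈ (0,1) there exist δ > 0 and c > 0 (depending only on n and ε) with the following property: for every k ≤ n, if f₁, …, f_{k+1} are DER data on the unit sphere S^{n−1} ⊆ ℝⁿ with ⟨f₁, f_i⟩ < −ε for all 2 ≤ i ≤ k+1 and ⟨f_i, f_j⟩ < δ for all 2 ≤ i ≠ j ≤ k+1, then there exists ξ ∈ S^{n−1} such that f₁(ξ) > c, f₂(ξ) < −c, and f_i(ξ) = 0 for all 3 ≤ i ≤ k+1. -/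
open scoped InnerProductSpace

noncomputable section

/-- DER data on the unit sphere of `EuclideanSpace ℝ (Fin n)`: a finite family of
nonempty compact subsets of the sphere together with nonnegative weights summing to at most 1. -/
structure DERData (n : ℕ) where
  m : ℕ
  w : Fin m → ℝ
  A : Fin m → Set (EuclideanSpace ℝ (Fin n))
  nonempty' : ∀ α, (A α).Nonempty
  compact' : ∀ α, IsCompact (A α)
  subset_sphere : ∀ α, A α ⊆ Metric.sphere (0 : EuclideanSpace ℝ (Fin n)) 1
  nonneg : ∀ α, 0 ≤ w α
  sum_le_one : ∑ α, w α ≤ 1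

/-- The DER function of DER data: `f(x) = -∑ a_α cos d(A_α, x) = -∑ a_α sup_{a ∈ A_α} ⟪a, x⟫`. -/
def DERData.toFun {n : ℕ} (f : DERData n) (x : EuclideanSpace ℝ (Fin n)) : ℝ :=
  -∑ α, f.w α * sSup ((fun a => ⟪a, x⟫_ℝ) '' f.A α)

/-- The scalar product of two DER data:
`⟨f,g⟩ = ∑_{α,β} a_α b_β cos d(A_α, B_β) = ∑_{α,β} a_α b_β sup_{a ∈ A_α, b ∈ B_β} ⟪a, b⟫`. -/
def DERData.sprod {n : ℕ} (f g : DERData n) : ℝ :=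
  ∑ α, ∑ β, f.w α * g.w β * sSup (Set.image2 (fun a b => ⟪a, b⟫_ℝ) (f.A α) (g.A β))


theorem aux_first {E : Type*} [NormedAddCommGroup E] [InnerProductSpace ℝ E] (z v : E)
    (h : ∀ t : ℝ, 0 < t → t ≤ 1 → ‖z‖ ≤ ‖z + t • v‖) : 0 ≤ ⟪v, z⟫_ℝ := by
  by_contra hneg
  push Not at hneg
  set a := -⟪v, z⟫_ℝ with ha
  have ha0 : 0 < a := by linarith
  set t := min 1 (a / (‖v‖ ^ 2 + 1)) with ht
  have hv : 0 < ‖v‖ ^ 2 + 1 := by positivity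
  have ht0 : 0 < t := lt_min one_pos (div_pos ha0 hv)
  have h1 := h t ht0 (min_le_left _ _)
  have h2 : t * (‖v‖ ^ 2 + 1) ≤ a := by
    rw [← le_div_iff₀ hv]; exact min_le_right _ _
  have h3 : ‖z‖ ^ 2 ≤ ‖z + t • v‖ ^ 2 := by gcongr
  rw [norm_add_sq_real, norm_smul, inner_smul_right, real_inner_comm, mul_pow,
    Real.norm_eq_abs, sq_abs] at h3
  have h4 : ⟪v, z⟫_ℝ = -a := by rw [ha]; ring
  rw [h4] at h3
  nlinarith [mul_pos ht0 ha0, mul_pos ht0 ht0]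

theorem aux_min {E : Type*} [NormedAddCommGroup E] [InnerProductSpace ℝ E]
    {ι : Type*} [Fintype ι] (K0 : Set E) (K : ι → Set E)
    (hK0 : IsCompact K0) (hK : ∀ i, IsCompact (K i)) (hc0 : Convex ℝ K0)
    (hc : ∀ i, Convex ℝ (K i)) (hne : ∀ i, (K i).Nonempty) (x0 : E) (hx0 : x0 ∈ K0)
    (hb0 : ∀ x ∈ K0, ‖x‖ ≤ 1) (ε : ℝ) (hε : 0 < ε) (hε1 : ε < 1)
    (hb : ∀ i, ∀ p ∈ K i, ⟪p, x0⟫_ℝ ≤ -ε) :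
    ∃ p0 ∈ K0, ∃ l : ι → ℝ, ∃ p : ι → E, (∀ i, 0 ≤ l i) ∧ (∀ i, p i ∈ K i) ∧
      ∑ i, l i ≤ 2 / ε ∧ ∃ z : E, z = p0 + ∑ i, l i • p i ∧
      (∀ x ∈ K0, ‖z‖ ^ 2 ≤ ⟪x, z⟫_ℝ) ∧ (∀ i, ∀ y ∈ K i, 0 ≤ ⟪y, z⟫_ℝ) ∧
      (∀ i, l i * ⟪p i, z⟫_ℝ = 0) ∧ ‖z‖ ≤ 1 := by
  classical
  set R := 3 / ε with hR
  have hR0 : 0 < R := by positivity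
  set S : Set (E × (ι → ℝ) × (ι → E)) :=
    K0 ×ˢ ((Set.univ.pi fun _ => Set.Icc 0 R) ×ˢ (Set.univ.pi K)) with hS
  have hScomp : IsCompact S :=
    hK0.prod ((isCompact_univ_pi fun _ => isCompact_Icc).prod (isCompact_univ_pi hK))
  choose q hq using hne
  have hmem : ∀ a l p, (a, l, p) ∈ S ↔
      a ∈ K0 ∧ (∀ i, 0 ≤ l i ∧ l i ≤ R) ∧ ∀ i, p i ∈ K i := by
    intro a l p
    simp [hS, Set.mem_pi, Pi.le_def, forall_and]
  have hSne : S.Nonempty :=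
    ⟨(x0, 0, q), (hmem _ _ _).2 ⟨hx0, fun i => ⟨le_rfl, hR0.le⟩, hq⟩⟩
  have hcont : ContinuousOn (fun u : E × (ι → ℝ) × (ι → E) =>
      ‖u.1 + ∑ i, u.2.1 i • u.2.2 i‖) S := by
    apply Continuous.continuousOn
    fun_prop
  obtain ⟨⟨p0, l, p⟩, hin, hmin⟩ := hScomp.exists_isMinOn hSne hcont
  obtain ⟨hp0, hl, hp⟩ := (hmem _ _ _).1 hin
  obtain ⟨z, hz⟩ : ∃ z, z = p0 + ∑ i, l i • p i := ⟨_, rfl⟩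
  have hmin' : ∀ (a : E) (l' : ι → ℝ) (p' : ι → E), a ∈ K0 → (∀ i, 0 ≤ l' i ∧ l' i ≤ R) → (∀ i, p' i ∈ K i) →
      ‖z‖ ≤ ‖a + ∑ i, l' i • p' i‖ := by
    intro a l' p' h1 h2 h3
    rw [hz]
    exact hmin ((hmem _ _ _).2 ⟨h1, h2, h3⟩)
  have hz1 : ‖z‖ ≤ 1 := by
    have := hmin' x0 0 q hx0 (fun i => ⟨le_rfl, hR0.le⟩) hq
    simp at this
    exact this.trans (hb0 _ hx0)
  have hsum : ∑ i, l i ≤ 2 / ε := by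
    rw [le_div_iff₀ hε]
    have h1 : ⟪∑ i, l i • p i, x0⟫_ℝ ≤ -((∑ i, l i) * ε) := by
      rw [sum_inner, Finset.sum_mul, ← Finset.sum_neg_distrib]
      apply Finset.sum_le_sum
      intro i _
      rw [real_inner_smul_left]
      nlinarith [hb i (p i) (hp i), (hl i).1]
    have h2 : ∑ i, l i • p i = z - p0 := by rw [hz]; abel
    rw [h2] at h1
    have h3 : ‖z - p0‖ ≤ 2 := (norm_sub_le _ _).trans (by linarith [hb0 _ hp0])
    have h4 := abs_le.1 (abs_real_inner_le_norm (z - p0) x0)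
    have h5 : ‖z - p0‖ * ‖x0‖ ≤ 2 * 1 :=
      mul_le_mul h3 (hb0 _ hx0) (norm_nonneg _) (by norm_num)
    linarith [h4.1]
  have hl' : ∀ i, l i ≤ 2 / ε := fun i =>
    (Finset.single_le_sum (fun j _ => (hl j).1) (Finset.mem_univ i)).trans hsum
  have hupd : ∀ i c v, p0 + ∑ j, Function.update l i c j • Function.update p i v j
      = z + (c • v - l i • p i) := by
    intro i c v
    have e1 : ∑ j, Function.update l i c j • Function.update p i v j
        = c • v + ∑ j ∈ Finset.univ.erase i, l j • p j := by
      rw [← Finset.add_sum_erase _ _ (Finset.mem_univ i)]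
      simp only [Function.update_self]
      congr 1
      apply Finset.sum_congr rfl
      intro j hj
      rw [Function.update_of_ne (Finset.ne_of_mem_erase hj),
        Function.update_of_ne (Finset.ne_of_mem_erase hj)]
    rw [e1, hz, ← Finset.add_sum_erase _ (fun j => l j • p j) (Finset.mem_univ i)]
    abel
  have hminu : ∀ i c v, 0 ≤ c → c ≤ R → v ∈ K i → ‖z‖ ≤ ‖z + (c • v - l i • p i)‖ := by
    intro i c v h1 h2 h3
    rw [← hupd]
    apply hmin' _ _ _ hp0
    · intro j
      by_cases hj : j = i
      · subst hj; simp [h1, h2]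
      · rw [Function.update_of_ne hj]; exact hl j
    · intro j
      by_cases hj : j = i
      · subst hj; simpa using h3
      · rw [Function.update_of_ne hj]; exact hp j
  have hA : ∀ i, ∀ y ∈ K i, 0 ≤ ⟪y, z⟫_ℝ := by
    intro i y hy
    apply aux_first
    intro t ht0 ht1
    have hpos : 0 < l i + t := by linarith [(hl i).1]
    have := hminu i (l i + t) ((l i / (l i + t)) • p i + (t / (l i + t)) • y) hpos.le
      (by
        have h1 : 1 ≤ 1 / ε := by rw [le_div_iff₀ hε]; linarith
        have h2 : R = 2 / ε + 1 / ε := by rw [hR]; ring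
        linarith [hl' i])
      (hc i (hp i) hy (div_nonneg (hl i).1 hpos.le) (div_nonneg ht0.le hpos.le)
        (by field_simp))
    rw [smul_add, smul_smul, smul_smul, mul_div_cancel₀ _ hpos.ne',
      mul_div_cancel₀ _ hpos.ne', add_sub_cancel_left] at this
    exact this
  have hB : ∀ i, l i * ⟪p i, z⟫_ℝ = 0 := by
    intro i
    apply le_antisymm _ (mul_nonneg (hl i).1 (hA i _ (hp i)))
    have : 0 ≤ ⟪-(l i • p i), z⟫_ℝ := by
      apply aux_first
      intro t ht0 ht1
      have := hminu i ((1 - t) * l i) (p i) (mul_nonneg (by linarith) (hl i).1)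
        (by nlinarith [(hl i).1, (hl i).2]) (hp i)
      convert this using 3
      rw [← sub_smul, smul_neg, smul_smul, ← neg_smul]
      congr 1; ring
    rw [inner_neg_left, real_inner_smul_left] at this
    linarith
  have hC : ‖z‖ ^ 2 = ⟪p0, z⟫_ℝ := by
    rw [← real_inner_self_eq_norm_sq]
    nth_rw 1 [hz]
    rw [inner_add_left, sum_inner]
    simp only [real_inner_smul_left, hB, Finset.sum_const_zero, add_zero]
  refine ⟨p0, hp0, l, p, fun i => (hl i).1, hp, hsum, z, hz, ?_, hA, hB, hz1⟩
  intro x hx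
  have : 0 ≤ ⟪x - p0, z⟫_ℝ := by
    apply aux_first
    intro t ht0 ht1
    have := hmin' ((1 - t) • p0 + t • x) l p
      (hc0 hp0 hx (by linarith) ht0.le (by ring)) hl hp
    convert this using 2
    rw [hz, sub_smul, smul_sub, one_smul]
    abel
  rw [inner_sub_left] at this
  linarith

/-- selections of DER data -/
def DERData.Ch {n : ℕ} (f : DERData n) : Set (EuclideanSpace ℝ (Fin n)) :=
  {y | ∃ a : Fin f.m → EuclideanSpace ℝ (Fin n), (∀ α, a α ∈ f.A α) ∧ y = ∑ α, f.w α • a α}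

/-- convex body of DER data -/
def DERData.body {n : ℕ} (f : DERData n) : Set (EuclideanSpace ℝ (Fin n)) :=
  {y | ∀ x, ⟪y, x⟫_ℝ ≤ -f.toFun x}

theorem DERData.exists_ch {n : ℕ} (f : DERData n) (x : EuclideanSpace ℝ (Fin n)) :
    ∃ y ∈ f.Ch, ⟪y, x⟫_ℝ = -f.toFun x := by
  have h : ∀ α, ∃ a ∈ f.A α, sSup ((fun a => ⟪a, x⟫_ℝ) '' f.A α) = ⟪a, x⟫_ℝ := by
    intro α
    exact (f.compact' α).exists_sSup_image_eq (f.nonempty' α)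
      (Continuous.continuousOn (by fun_prop))
  choose a ha hs using h
  refine ⟨_, ⟨a, ha, rfl⟩, ?_⟩
  simp only [DERData.toFun, neg_neg, sum_inner, real_inner_smul_left, hs]

theorem DERData.ch_sub {n : ℕ} (f : DERData n) : f.Ch ⊆ f.body := by
  rintro y ⟨a, ha, rfl⟩ x
  simp only [DERData.toFun, neg_neg, sum_inner, real_inner_smul_left]
  apply Finset.sum_le_sum
  intro α _
  apply mul_le_mul_of_nonneg_left _ (f.nonneg α)
  apply le_csSup
  · exact ((f.compact' α).image (by fun_prop)).bddAbove
  · exact ⟨a α, ha α, rfl⟩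

theorem DERData.ch_ch {n : ℕ} (f g : DERData n) (x y : EuclideanSpace ℝ (Fin n))
    (hx : x ∈ f.Ch) (hy : y ∈ g.Ch) : ⟪x, y⟫_ℝ ≤ f.sprod g := by
  obtain ⟨a, ha, rfl⟩ := hx
  obtain ⟨b, hb, rfl⟩ := hy
  simp only [DERData.sprod, sum_inner, real_inner_smul_left]
  apply Finset.sum_le_sum
  intro α _
  rw [inner_sum, Finset.mul_sum]
  apply Finset.sum_le_sum
  intro β _
  rw [real_inner_smul_right, ← mul_assoc]
  apply mul_le_mul_of_nonneg_left _ (mul_nonneg (f.nonneg α) (g.nonneg β))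
  apply le_csSup
  · rw [← Set.image_prod]
    exact (((f.compact' α).prod (g.compact' β)).image (by fun_prop)).bddAbove
  · exact ⟨a α, ha α, b β, hb β, rfl⟩

theorem DERData.body_ch {n : ℕ} (f g : DERData n) (x y : EuclideanSpace ℝ (Fin n))
    (hx : x ∈ f.body) (hy : y ∈ g.Ch) : ⟪x, y⟫_ℝ ≤ f.sprod g := by
  obtain ⟨x', hx', h⟩ := f.exists_ch y
  exact (hx y).trans (h ▸ f.ch_ch g x' y hx' hy)

theorem DERData.body_ch' {n : ℕ} (f g : DERData n) (x y : EuclideanSpace ℝ (Fin n))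
    (hx : x ∈ f.Ch) (hy : y ∈ g.body) : ⟪y, x⟫_ℝ ≤ f.sprod g := by
  obtain ⟨y', hy', h⟩ := g.exists_ch x
  refine (hy x).trans (h ▸ ?_)
  rw [real_inner_comm]
  exact f.ch_ch g x y' hx hy'

theorem DERData.ch_norm {n : ℕ} (f : DERData n) (x : EuclideanSpace ℝ (Fin n))
    (hx : x ∈ f.Ch) : ‖x‖ ≤ 1 := by
  obtain ⟨a, ha, rfl⟩ := hx
  refine (norm_sum_le _ _).trans (le_trans (Finset.sum_le_sum ?_) f.sum_le_one)
  intro α _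
  have : ‖a α‖ = 1 := by simpa using f.subset_sphere α (ha α)
  rw [norm_smul, this, mul_one, Real.norm_of_nonneg (f.nonneg α)]

theorem DERData.body_norm {n : ℕ} (f : DERData n) (x : EuclideanSpace ℝ (Fin n))
    (hx : x ∈ f.body) : ‖x‖ ≤ 1 := by
  obtain ⟨y, hy, h⟩ := f.exists_ch x
  have h1 := hx x
  rw [← h, real_inner_self_eq_norm_sq] at h1
  have h2 := real_inner_le_norm y x
  have h3 := f.ch_norm y hy
  nlinarith [norm_nonneg x, norm_nonneg y]

theorem DERData.body_convex {n : ℕ} (f : DERData n) : Convex ℝ f.body := by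
  intro x hx y hy a b ha hb hab v
  rw [inner_add_left, real_inner_smul_left, real_inner_smul_left]
  have h1 := mul_le_mul_of_nonneg_left (hx v) ha
  have h2 := mul_le_mul_of_nonneg_left (hy v) hb
  have h3 : -f.toFun v = a * -f.toFun v + b * -f.toFun v := by rw [← add_mul, hab, one_mul]
  linarith

theorem DERData.body_compact {n : ℕ} (f : DERData n) : IsCompact f.body := by
  apply Metric.isCompact_of_isClosed_isBounded
  · have : f.body = ⋂ x, {y | ⟪y, x⟫_ℝ ≤ -f.toFun x} := by
      ext y; simp [DERData.body]
    rw [this]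
    exact isClosed_iInter fun x => isClosed_le (by fun_prop) continuous_const
  · apply (Metric.isBounded_closedBall (x := (0 : EuclideanSpace ℝ (Fin n))) (r := 1)).subset
    intro x hx
    simpa using f.body_norm x hx


/-- Lemma 5.2(1) (round-sphere case). Here `f 0, f 1, …, f k` play the roles of
`f₁, f₂, …, f_{k+1}`. -/
theorem stmt_1 (n : ℕ) (hn : 2 ≤ n) (ε : ℝ) (hε : ε ∈ Set.Ioo (0 : ℝ) 1) :
    ∃ δ > (0 : ℝ), ∃ c > (0 : ℝ), ∀ k : ℕ, 1 ≤ k → k ≤ n →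
      ∀ f : Fin (k + 1) → DERData n,
        (∀ i : Fin (k + 1), 1 ≤ (i : ℕ) → (f 0).sprod (f i) < -ε) →
        (∀ i j : Fin (k + 1), 1 ≤ (i : ℕ) → 1 ≤ (j : ℕ) → i ≠ j → (f i).sprod (f j) < δ) →
        ∃ ξ : EuclideanSpace ℝ (Fin n), ‖ξ‖ = 1 ∧
          c < (f 0).toFun ξ ∧ (f 1).toFun ξ < -c ∧
          ∀ i : Fin (k + 1), 2 ≤ (i : ℕ) → (f i).toFun ξ = 0 := by
  obtain ⟨hε0, hε1⟩ := hε
  refine ⟨ε ^ 2 / 4, by positivity, ε ^ 2 / 8, by positivity, ?_⟩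
  intro k hk1 hkn f hf0 hfd
  obtain ⟨x0, hx0, -⟩ := (f 0).exists_ch 0
  obtain ⟨p0, hp0, l, p, hl, hp, hsum, z, hz, hzK0, hzK, hcomp, hz1⟩ :=
    aux_min (ι := {i : Fin (k + 1) // 2 ≤ (i : ℕ)}) (f 0).body (fun i => (f i.1).body)
      (f 0).body_compact (fun i => (f i.1).body_compact) (f 0).body_convex
      (fun i => (f i.1).body_convex)
      (fun i => by
        obtain ⟨y, hy, -⟩ := (f i.1).exists_ch 0
        exact ⟨y, (f i.1).ch_sub hy⟩)
      x0 ((f 0).ch_sub hx0) (f 0).body_norm ε hε0 hε1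
      (fun i q hq => ((f 0).body_ch' (f i.1) x0 q hx0 hq).trans
        (hf0 i.1 (by have := i.2; omega)).le)
  -- key estimate
  have key : ∀ i : Fin (k + 1), 1 ≤ (i : ℕ) → (∀ j : {i : Fin (k + 1) // 2 ≤ (i : ℕ)},
      j.1 = i → l j = 0) → ∀ y ∈ (f i).Ch, ⟪y, z⟫_ℝ ≤ -(ε / 2) := by
    intro i hi hli y hy
    rw [real_inner_comm, hz, inner_add_left, sum_inner]
    have h1 := ((f 0).body_ch (f i) p0 y hp0 hy).trans (hf0 i hi).le
    have h2 : ∑ j, ⟪l j • p j, y⟫_ℝ ≤ ∑ j, l j * (ε ^ 2 / 4) := by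
      apply Finset.sum_le_sum
      intro j _
      rw [real_inner_smul_left]
      by_cases hj : j.1 = i
      · simp [hli j hj]
      · apply mul_le_mul_of_nonneg_left _ (hl j)
        exact ((f j.1).body_ch (f i) (p j) y (hp j) hy).trans
          (hfd j.1 i (by have := j.2; omega) hi hj).le
    rw [← Finset.sum_mul] at h2
    have h3 : (∑ j, l j) * (ε ^ 2 / 4) ≤ 2 / ε * (ε ^ 2 / 4) := by gcongr
    have h4 : 2 / ε * (ε ^ 2 / 4) = ε / 2 := by field_simp; norm_num
    linarith
  have hone : ((1 : Fin (k + 1)) : ℕ) = 1 := by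
    rw [Fin.val_one', Nat.mod_eq_of_lt (by omega)]
  obtain ⟨y1, hy1, -⟩ := (f 1).exists_ch 0
  have hk1' := key 1 (by omega) (by
    intro j hj
    have := j.2
    rw [hj] at this
    omega) y1 hy1
  have hzlow : ε / 2 ≤ ‖z‖ := by
    have h1 := (abs_le.1 (abs_real_inner_le_norm y1 z)).1
    have h2 := (f 1).ch_norm y1 hy1
    nlinarith [norm_nonneg z]
  have hzpos : 0 < ‖z‖ := by linarith
  have hin : ∀ y : EuclideanSpace ℝ (Fin n), ⟪y, (-‖z‖⁻¹) • z⟫_ℝ = -(⟪y, z⟫_ℝ / ‖z‖) := by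
    intro y
    rw [real_inner_smul_right]; ring
  refine ⟨(-‖z‖⁻¹) • z, ?_, ?_, ?_, ?_⟩
  · rw [norm_smul, norm_neg, norm_inv, norm_norm, inv_mul_cancel₀ hzpos.ne']
  · obtain ⟨x, hx, he⟩ := (f 0).exists_ch ((-‖z‖⁻¹) • z)
    rw [hin] at he
    have h1 := hzK0 x ((f 0).ch_sub hx)
    have h2 : ‖z‖ ≤ ⟪x, z⟫_ℝ / ‖z‖ := by rw [le_div_iff₀ hzpos]; nlinarith
    nlinarith
  · have h1 := (f 1).ch_sub hy1 ((-‖z‖⁻¹) • z)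
    rw [hin] at h1
    have h2 : ⟪y1, z⟫_ℝ / ‖z‖ ≤ -(ε / 2) := by rw [div_le_iff₀ hzpos]; nlinarith
    nlinarith
  · intro i hi
    apply le_antisymm
    · by_cases hli : l ⟨i, hi⟩ = 0
      · obtain ⟨y, hy, -⟩ := (f i).exists_ch 0
        have h1 := key i (by omega) (by
          intro j hj
          subst hj
          exact hli) y hy
        have h2 := (f i).ch_sub hy ((-‖z‖⁻¹) • z)
        rw [hin] at h2
        have h3 : ⟪y, z⟫_ℝ / ‖z‖ ≤ 0 := div_nonpos_of_nonpos_of_nonneg (by linarith) hzpos.le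
        linarith
      · have h1 : ⟪p ⟨i, hi⟩, z⟫_ℝ = 0 := (mul_eq_zero.1 (hcomp ⟨i, hi⟩)).resolve_left hli
        have h2 := hp ⟨i, hi⟩ ((-‖z‖⁻¹) • z)
        rw [hin, h1, zero_div] at h2
        simp only at h2
        linarith
    · obtain ⟨y, hy, he⟩ := (f i).exists_ch ((-‖z‖⁻¹) • z)
      rw [hin] at he
      have h1 := hzK ⟨i, hi⟩ y ((f i).ch_sub hy)
      have h2 := div_nonneg h1 hzpos.le
      linarith

end
end

section
/- For every integer n ≥ 2, every ε ∈ (0,1), and every κ > 0 there exist δ > 0 and c > 0 (depending only on n, ε, κ) with the following property: for every k ≤ n, if f₁, …, f_{k+1} are DER data on the unit sphere S^{n−1} ⊆ ℝⁿ with ⟨f₁, f_i⟩ < −ε for all 3 ≤ i ≤ k+1, ⟨f₁, f₂⟩ < δ, sup_{x ∈ S^{n−1}} f₂(x) > ε, and ⟨f_i, f_j⟩ < δ for all 2 ≤ i ≠ j ≤ k+1, then there exists ξ ∈ S^{n−1} such that f₁(ξ) > −κ, f₂(ξ) < −c, and f_i(ξ) = 0 for all 3 ≤ i ≤ k+1.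 -/
open scoped InnerProductSpace

noncomputable section

section core
variable {E : Type*} [NormedAddCommGroup E] [InnerProductSpace ℝ E]

/-- polar cone -/
def polC (G : Set E) : Set E := {x | ∀ u ∈ G, ⟪x, u⟫_ℝ ≤ 0}

theorem polC_closed (G : Set E) : IsClosed (polC G) := by
  have : polC G = ⋂ u ∈ G, {x | ⟪x, u⟫_ℝ ≤ 0} := by
    ext x; simp [polC]
  rw [this]
  exact isClosed_biInter fun u _ => isClosed_le (by fun_prop) continuous_const

theorem polC_add {G : Set E} {x y : E} (hx : x ∈ polC G) (hy : y ∈ polC G) : x + y ∈ polC G := by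
  intro u hu
  rw [inner_add_left]
  linarith [hx u hu, hy u hu]

theorem polC_smul {G : Set E} {x : E} {t : ℝ} (ht : 0 ≤ t) (hx : x ∈ polC G) :
    t • x ∈ polC G := by
  intro u hu
  rw [real_inner_smul_left]
  exact mul_nonpos_of_nonneg_of_nonpos ht (hx u hu)

theorem polC_zero (G : Set E) : (0 : E) ∈ polC G := by
  intro u _; simp

theorem sub_polpol (G : Set E) : G ⊆ polC (polC G) := by
  intro u hu y hy
  rw [real_inner_comm]; exact hy u hu

theorem moreau [CompleteSpace E] (G : Set E) (x : E) :
    ∃ d ∈ polC (polC G), x - d ∈ polC G ∧ ⟪x - d, d⟫_ℝ = 0 := by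
  have hconv : Convex ℝ (polC (polC G)) := by
    intro a ha b hb s t hs ht _
    exact polC_add (polC_smul hs ha) (polC_smul ht hb)
  obtain ⟨d, hd, hmin⟩ := exists_norm_eq_iInf_of_complete_convex (K := polC (polC G))
    ⟨0, polC_zero _⟩ (polC_closed _).isComplete hconv x
  have h := (norm_eq_iInf_iff_real_inner_le_zero hconv hd).1 hmin
  have h2 := h (d + d) (polC_add hd hd)
  have h0 := h 0 (polC_zero _)
  simp only [add_sub_cancel_right, zero_sub, inner_neg_right] at h2 h0
  have hz : ⟪x - d, d⟫_ℝ = 0 := by linarith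
  refine ⟨d, hd, ?_, hz⟩
  intro u hu
  have := h u (sub_polpol G hu)
  rw [inner_sub_right] at this
  linarith

set_option maxHeartbeats 2000000 in
theorem core [FiniteDimensional ℝ E] {ι : Type*} (G : ι → Set E) (K0 : Set E) (u0 u1 : E)
    (ε δ β : ℝ) (hε : 0 < ε) (hε1 : ε < 1) (hδ : 0 < δ) (hβ : β = 6 * δ / ε ^ 3)
    (hβ1 : β ≤ ε ^ 2 / 6)
    (hu0 : u0 ∈ K0) (hK0 : ∀ a ∈ K0, ‖a‖ ≤ 1)
    (hKG : ∀ a ∈ K0, ∀ i, ∀ u ∈ G i, ⟪a, u⟫_ℝ ≤ -ε)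
    (hK1 : ∀ a ∈ K0, ⟪a, u1⟫_ℝ ≤ δ)
    (hu1 : ‖u1‖ ≤ 1) (hu1' : ε < ‖u1‖)
    (hGn : ∀ i, (G i).Nonempty)
    (hG1 : ∀ i, ∀ u ∈ G i, ‖u‖ ≤ 1)
    (hGu1 : ∀ i, ∀ u ∈ G i, ⟪u1, u⟫_ℝ ≤ δ)
    (hGG : ∀ i j, i ≠ j → ∀ u ∈ G i, ∀ v ∈ G j, ⟪u, v⟫_ℝ ≤ δ) :
    ∃ q : E, ε ^ 2 / 4 ≤ ‖q‖ ∧ ‖q‖ ^ 2 - β * ‖q‖ ≤ ⟪u1, q⟫_ℝ ∧ (∀ a ∈ K0, ⟪a, q⟫_ℝ ≤ 2 * β) ∧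
      (∀ i, ∀ u ∈ G i, ⟪u, q⟫_ℝ ≤ 0) ∧ ∀ i, ∀ η > 0, ∃ u ∈ G i, -η < ⟪u, q⟫_ℝ := by
  have : CompleteSpace E := FiniteDimensional.complete ℝ E
  set GG : Set E := ⋃ i, G i with hGGdef
  set D := polC (polC GG) with hD
  have hmemD : ∀ i, ∀ u ∈ G i, u ∈ D := fun i u hu => sub_polpol GG (Set.mem_iUnion.2 ⟨i, hu⟩)
  have hCiff : ∀ y, y ∈ polC GG ↔ ∀ i, ∀ u ∈ G i, ⟪y, u⟫_ℝ ≤ 0 := by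
    intro y; simp only [polC, hGGdef, Set.mem_iUnion, Set.mem_ofPred_eq]
    exact ⟨fun h i u hu => h u ⟨i, hu⟩, fun h u ⟨i, hu⟩ => h i u hu⟩
  have hDC : ∀ v ∈ D, ∀ y ∈ polC GG, ⟪y, v⟫_ℝ ≤ 0 := by
    intro v hv y hy; rw [real_inner_comm]; exact hv y hy
  -- estimates
  have e1 : ∀ v ∈ D, ∀ a ∈ K0, ⟪a, v⟫_ℝ ≤ -(ε * ‖v‖) := by
    intro v hv a ha
    by_cases hv0 : v = 0
    · simp [hv0]
    have hn : 0 < ‖v‖ := norm_pos_iff.2 hv0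
    have := hDC v hv (a + (ε * ‖v‖⁻¹) • v) ((hCiff _).2 ?_)
    · rw [inner_add_left, real_inner_smul_left, real_inner_self_eq_norm_sq] at this
      have h2 : ε * ‖v‖⁻¹ * ‖v‖ ^ 2 = ε * ‖v‖ := by field_simp
      linarith
    · intro i u hu
      rw [inner_add_left, real_inner_smul_left]
      have h1 := hKG a ha i u hu
      have h2 : ⟪v, u⟫_ℝ ≤ ‖v‖ := by
        have := real_inner_le_norm v u
        nlinarith [hG1 i u hu]
      have h3 : ε * ‖v‖⁻¹ * ⟪v, u⟫_ℝ ≤ ε * ‖v‖⁻¹ * ‖v‖ :=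
        mul_le_mul_of_nonneg_left h2 (by positivity)
      have h4 : ε * ‖v‖⁻¹ * ‖v‖ = ε := by field_simp
      linarith
  have abs1 : ∀ a ∈ K0, ∀ v, |⟪a, v⟫_ℝ| ≤ ‖v‖ := by
    intro a ha v
    have := abs_real_inner_le_norm a v
    nlinarith [hK0 a ha, norm_nonneg v]
  have e2 : ∀ (x : E) (s : ℝ), 0 ≤ s → (∀ i, ∀ u ∈ G i, ⟪x, u⟫_ℝ ≤ s * δ) →
      ∃ d ∈ D, x - d ∈ polC GG ∧ ‖d‖ ≤ s * (δ / ε) := by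
    intro x s hs hx
    obtain ⟨d, hd, hC, hz⟩ := moreau GG x
    refine ⟨d, hd, hC, ?_⟩
    have h1 := hDC d hd (x + (s * (δ / ε)) • u0) ((hCiff _).2 ?_)
    · rw [inner_add_left, real_inner_smul_left] at h1
      rw [inner_sub_left, real_inner_self_eq_norm_sq] at hz
      have h2 := (abs_le.1 (abs1 u0 hu0 d)).1
      have hp : 0 ≤ s * (δ / ε) := by positivity
      have h3 := mul_le_mul_of_nonneg_left h2 hp
      have h4 : ‖d‖ * ‖d‖ ≤ s * (δ / ε) * ‖d‖ := by nlinarith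
      by_cases hd0 : ‖d‖ = 0
      · rw [hd0]; exact hp
      · exact le_of_mul_le_mul_right h4 (lt_of_le_of_ne (norm_nonneg d) (Ne.symm hd0))
    · intro i u hu
      rw [inner_add_left, real_inner_smul_left]
      have h2 := hx i u hu
      have hp : 0 ≤ s * (δ / ε) := by positivity
      have h3 := mul_le_mul_of_nonneg_left (hKG u0 hu0 i u hu) hp
      have h4 : s * (δ / ε) * (-ε) = -(s * δ) := by field_simp
      linarith
  set S : Set (E × E) := {z | z.1 ∈ D ∧ z.2 ∈ D ∧ u1 + z.1 - z.2 ∈ polC GG ∧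
    -⟪u0, z.2⟫_ℝ ≤ δ / ε ^ 2 * (1 - ⟪u0, z.1⟫_ℝ)} with hS
  have hβδ : δ = β * ε ^ 3 / 6 := by rw [hβ]; field_simp
  have hβpos : 0 < β := by rw [hβ]; positivity
  have hθ : δ / ε ^ 2 = β * ε / 6 := by rw [hβδ]; field_simp
  have hε2 : ε ^ 2 < 1 := by nlinarith
  have hε3 : ε ^ 3 < 1 := by nlinarith
  have hδβ : δ ≤ β / 6 := by rw [hβδ]; nlinarith
  have bnd : ∀ z ∈ S, -⟪u0, z.1⟫_ℝ ≤ 5 ∧ ‖z.2‖ ≤ β ∧ ε * ‖z.1‖ ≤ -⟪u0, z.1⟫_ℝ := by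
    rintro ⟨N, P⟩ ⟨hN, hP, hC, hm⟩
    simp only at hN hP hC hm ⊢
    set q := u1 + N - P with hq
    have a1 := e1 N hN u0 hu0
    have a2 := e1 P hP u0 hu0
    have hqN := hDC N hN q hC
    have hqq : ‖q‖ ^ 2 = ⟪q, u1⟫_ℝ + ⟪q, N⟫_ℝ - ⟪q, P⟫_ℝ := by
      rw [← real_inner_self_eq_norm_sq]
      conv_lhs => rw [hq]
      rw [← hq, inner_sub_left, inner_add_left, real_inner_comm q u1, real_inner_comm q N,
        real_inner_comm q P]
    have b1 : ⟪q, u1⟫_ℝ ≤ ‖q‖ := by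
      have := real_inner_le_norm q u1
      nlinarith [norm_nonneg q]
    have b2 := (abs_le.1 (abs_real_inner_le_norm q P)).1
    have b3 : ‖q‖ ≤ 1 + ‖P‖ := by
      by_contra hcon
      push Not at hcon
      nlinarith [norm_nonneg q, norm_nonneg P]
    have b4 : -⟪u0, q⟫_ℝ ≤ ‖q‖ := by
      have := (abs_le.1 (abs1 u0 hu0 q)).1; linarith
    have b5 : ⟪u0, q⟫_ℝ = ⟪u0, u1⟫_ℝ + ⟪u0, N⟫_ℝ - ⟪u0, P⟫_ℝ := by
      rw [hq, inner_sub_right, inner_add_right]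
    have b6 := hK1 u0 hu0
    have b7 := (abs_le.1 (abs1 u0 hu0 P)).1
    rw [hθ] at hm
    have hPb : ‖P‖ ≤ β / 6 * (1 - ⟪u0, N⟫_ℝ) := by
      have : ε * ‖P‖ ≤ ε * (β / 6 * (1 - ⟪u0, N⟫_ℝ)) := by linarith
      exact le_of_mul_le_mul_left this hε
    have hNn : 0 ≤ -⟪u0, N⟫_ℝ := by nlinarith [norm_nonneg N]
    have hN5 : -⟪u0, N⟫_ℝ ≤ 5 := by nlinarith
    refine ⟨hN5, by nlinarith, by linarith⟩
  have hScl : IsClosed S := by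
    have h1 : IsClosed {z : E × E | z.1 ∈ D} := (polC_closed _).preimage continuous_fst
    have h2 : IsClosed {z : E × E | z.2 ∈ D} := (polC_closed _).preimage continuous_snd
    have h3 : IsClosed {z : E × E | u1 + z.1 - z.2 ∈ polC GG} :=
      (polC_closed _).preimage (by fun_prop)
    have h4 : IsClosed {z : E × E | -⟪u0, z.2⟫_ℝ ≤ δ / ε ^ 2 * (1 - ⟪u0, z.1⟫_ℝ)} :=
      isClosed_le (by fun_prop) (by fun_prop)
    exact h1.inter (h2.inter (h3.inter h4))
  have hScpt : IsCompact S := by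
    have : ProperSpace (E × E) := FiniteDimensional.proper ℝ (E × E)
    refine Metric.isCompact_of_isClosed_isBounded hScl ?_
    refine (Metric.isBounded_closedBall (x := (0 : E × E)) (r := 5 / ε + β)).subset ?_
    intro z hz
    obtain ⟨h1, h2, h3⟩ := bnd z hz
    have h5 : 0 < 5 / ε := by positivity
    rw [mem_closedBall_zero_iff, Prod.norm_def, max_le_iff]
    constructor
    · have : ‖z.1‖ ≤ 5 / ε := by rw [le_div_iff₀ hε]; linarith
      linarith
    · linarith
  have hSne : S.Nonempty := by
    obtain ⟨d, hd, hC, hdn⟩ := e2 u1 1 zero_le_one (fun i u hu => by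
      rw [one_mul]; exact hGu1 i u hu)
    refine ⟨(0, d), polC_zero _, hd, by simpa using hC, ?_⟩
    simp only [inner_zero_right, sub_zero, mul_one]
    have h1 := (abs_le.1 (abs1 u0 hu0 d)).1
    have h2 : δ / ε ≤ δ / ε ^ 2 := by
      apply div_le_div_of_nonneg_left hδ.le (by positivity); nlinarith
    linarith
  obtain ⟨⟨N, P⟩, hz, hmax⟩ := hScpt.exists_isMaxOn hSne
    (f := fun z : E × E => -⟪u0, z.1⟫_ℝ) (by fun_prop)
  obtain ⟨c1, c2, c3⟩ := bnd _ hz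
  obtain ⟨hN, hP, hC, hm⟩ := hz
  simp only at hN hP hC hm c1 c2 c3
  set q := u1 + N - P with hq
  have hqN := hDC N hN q hC
  have hin : ∀ a : E, ⟪a, q⟫_ℝ = ⟪a, u1⟫_ℝ + ⟪a, N⟫_ℝ - ⟪a, P⟫_ℝ := by
    intro a; rw [hq, inner_sub_right, inner_add_right]
  refine ⟨q, ?_, ?_, ?_, ?_, ?_⟩
  · by_contra hcon
    push Not at hcon
    have b5 := hin u0
    have b4 := (abs_le.1 (abs1 u0 hu0 q)).1
    have b6 := hK1 u0 hu0
    have b7 := (abs_le.1 (abs1 u0 hu0 P)).1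
    have b7' := (abs_le.1 (abs1 u0 hu0 P)).2
    have g1 : ε * ‖N‖ ≤ δ + ‖q‖ + β := by linarith
    have g2 : ‖u1‖ ≤ ‖q‖ + ‖N‖ + ‖P‖ := by
      have : u1 = q - N + P := by rw [hq]; abel
      calc ‖u1‖ = ‖q - N + P‖ := by rw [← this]
        _ ≤ ‖q - N‖ + ‖P‖ := norm_add_le _ _
        _ ≤ _ := by linarith [norm_sub_le q N]
    have g3 : ε * ε < ε * (‖q‖ + ‖N‖ + ‖P‖) :=
      mul_lt_mul_of_pos_left (by linarith) hε
    have g4 : ε * ‖q‖ ≤ ‖q‖ := by nlinarith [norm_nonneg q]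
    have g5 : ε * ‖P‖ ≤ ‖P‖ := by nlinarith [norm_nonneg P]
    have g6 : ε * (‖q‖ + ‖N‖ + ‖P‖) = ε * ‖q‖ + ε * ‖N‖ + ε * ‖P‖ := by ring
    have g7 : ε * ε = ε ^ 2 := by ring
    have g8 : 0 < ε ^ 2 := by positivity
    linarith
  · have hqq : ‖q‖ ^ 2 = ⟪q, u1⟫_ℝ + ⟪q, N⟫_ℝ - ⟪q, P⟫_ℝ := by
      rw [← real_inner_self_eq_norm_sq]; exact hin q
    have b2 := (abs_le.1 (abs_real_inner_le_norm q P)).1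
    rw [real_inner_comm]
    nlinarith [norm_nonneg q]
  · intro a ha
    have h1 := hin a
    have h2 := e1 N hN a ha
    have h3 := (abs_le.1 (abs1 a ha P)).1
    have h4 := hK1 a ha
    nlinarith [norm_nonneg N]
  · intro i u hu
    rw [real_inner_comm]; exact (hCiff q).1 hC i u hu
  · intro j η hη
    by_contra hcon
    push Not at hcon
    obtain ⟨w, hw⟩ := hGn j
    obtain ⟨d, hd, hC', hdn⟩ := e2 (q + η • w) η hη.le (by
      intro i u hu
      rw [inner_add_left, real_inner_smul_left]
      by_cases hij : j = i
      · subst hij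
        have h1 := hcon u hu
        rw [real_inner_comm] at h1
        have h2 : ⟪w, u⟫_ℝ ≤ 1 := by
          have := real_inner_le_norm w u
          nlinarith [hG1 j u hu, hG1 j w hw, norm_nonneg u, norm_nonneg w]
        nlinarith
      · have h1 := (hCiff q).1 hC i u hu
        have h2 := hGG j i hij w hw u hu
        nlinarith)
    have hwK := hKG u0 hu0 j w hw
    have hmem : (N + η • w, P + d) ∈ S := by
      refine ⟨polC_add hN (polC_smul hη.le (hmemD j w hw)), polC_add hP hd, ?_, ?_⟩
      · have : u1 + (N + η • w) - (P + d) = q + η • w - d := by rw [hq]; abel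
        simp only [this]; exact hC'
      · simp only [inner_add_right, real_inner_smul_right]
        have h1 := (abs_le.1 (abs1 u0 hu0 d)).1
        have h2 : δ / ε ^ 2 * (η * ε) = η * (δ / ε) := by field_simp
        have h3 : δ / ε ^ 2 * (η * ε) ≤ δ / ε ^ 2 * (η * (-⟪u0, w⟫_ℝ)) := by
          apply mul_le_mul_of_nonneg_left _ (by positivity)
          apply mul_le_mul_of_nonneg_left _ hη.le
          linarith
        nlinarith
    have := hmax hmem
    simp only [Set.mem_ofPred_eq, inner_add_right, real_inner_smul_right] at this
    nlinarith

end core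

/-- selections -/
def DERData.K {n : ℕ} (f : DERData n) : Set (EuclideanSpace ℝ (Fin n)) :=
  {u | ∃ a : Fin f.m → EuclideanSpace ℝ (Fin n), (∀ α, a α ∈ f.A α) ∧ u = ∑ α, f.w α • a α}

theorem DERData.K_norm {n : ℕ} (f : DERData n) : ∀ u ∈ f.K, ‖u‖ ≤ 1 := by
  rintro u ⟨a, ha, rfl⟩
  refine (norm_sum_le _ _).trans (le_trans (Finset.sum_le_sum fun α _ => ?_) f.sum_le_one)
  have : ‖a α‖ = 1 := by simpa using f.subset_sphere α (ha α)
  rw [norm_smul, this, mul_one, Real.norm_of_nonneg (f.nonneg α)]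

theorem DERData.K_nonempty {n : ℕ} (f : DERData n) : f.K.Nonempty := by
  choose a ha using f.nonempty'
  exact ⟨_, a, ha, rfl⟩

theorem DERData.K_le {n : ℕ} (f : DERData n) (x : EuclideanSpace ℝ (Fin n)) :
    ∀ u ∈ f.K, ⟪u, x⟫_ℝ ≤ - f.toFun x := by
  rintro u ⟨a, ha, rfl⟩
  rw [DERData.toFun, neg_neg, sum_inner]
  refine Finset.sum_le_sum fun α _ => ?_
  rw [real_inner_smul_left]
  refine mul_le_mul_of_nonneg_left ?_ (f.nonneg α)
  exact le_csSup ((f.compact' α).image (by fun_prop)).bddAbove ⟨_, ha α, rfl⟩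

theorem DERData.K_att {n : ℕ} (f : DERData n) (x : EuclideanSpace ℝ (Fin n)) :
    ∃ u ∈ f.K, ⟪u, x⟫_ℝ = - f.toFun x := by
  have : ∀ α, ∃ a ∈ f.A α, sSup ((fun a => ⟪a, x⟫_ℝ) '' f.A α) = ⟪a, x⟫_ℝ := fun α =>
    (f.compact' α).exists_sSup_image_eq (f.nonempty' α) (by fun_prop)
  choose a ha hs using this
  refine ⟨_, ⟨a, ha, rfl⟩, ?_⟩
  rw [DERData.toFun, neg_neg, sum_inner]
  refine Finset.sum_congr rfl fun α _ => ?_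
  rw [real_inner_smul_left, hs]

theorem DERData.K_sprod {n : ℕ} (f g : DERData n) :
    ∀ u ∈ f.K, ∀ v ∈ g.K, ⟪u, v⟫_ℝ ≤ f.sprod g := by
  rintro u ⟨a, ha, rfl⟩ v ⟨b, hb, rfl⟩
  rw [DERData.sprod, sum_inner]
  refine Finset.sum_le_sum fun α _ => ?_
  rw [inner_sum]
  refine Finset.sum_le_sum fun β _ => ?_
  rw [real_inner_smul_left, real_inner_smul_right, ← mul_assoc]
  refine mul_le_mul_of_nonneg_left ?_ (mul_nonneg (f.nonneg α) (g.nonneg β))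
  refine le_csSup ?_ ⟨_, ha α, _, hb β, rfl⟩
  refine ⟨1, ?_⟩
  rintro _ ⟨p, hp, r, hr, rfl⟩
  have h1 : ‖p‖ = 1 := by simpa using f.subset_sphere α hp
  have h2 : ‖r‖ = 1 := by simpa using g.subset_sphere β hr
  have := real_inner_le_norm p r
  rw [h1, h2] at this
  simpa using this

/-- Lemma 5.2(2) (round-sphere case). Here `f 0, f 1, …, f k` play the roles of
`f₁, f₂, …, f_{k+1}`. -/
theorem stmt_2 (n : ℕ) (hn : 2 ≤ n) (ε : ℝ) (hε : ε ∈ Set.Ioo (0 : ℝ) 1)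
    (κ : ℝ) (hκ : 0 < κ) :
    ∃ δ > (0 : ℝ), ∃ c > (0 : ℝ), ∀ k : ℕ, 1 ≤ k → k ≤ n →
      ∀ f : Fin (k + 1) → DERData n,
        (∀ i : Fin (k + 1), 2 ≤ (i : ℕ) → (f 0).sprod (f i) < -ε) →
        (f 0).sprod (f 1) < δ →
        ε < sSup ((f 1).toFun '' Metric.sphere (0 : EuclideanSpace ℝ (Fin n)) 1) →
        (∀ i j : Fin (k + 1), 1 ≤ (i : ℕ) → 1 ≤ (j : ℕ) → i ≠ j → (f i).sprod (f j) < δ) →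
        ∃ ξ : EuclideanSpace ℝ (Fin n), ‖ξ‖ = 1 ∧
          -κ < (f 0).toFun ξ ∧ (f 1).toFun ξ < -c ∧
          ∀ i : Fin (k + 1), 2 ≤ (i : ℕ) → (f i).toFun ξ = 0 := by
  obtain ⟨hε0, hε1⟩ := hε
  set β : ℝ := min (ε ^ 2 / 6) (κ * ε ^ 2 / 16) with hβdef
  have hβpos : 0 < β := lt_min (by positivity) (by positivity)
  have hβ1 : β ≤ ε ^ 2 / 6 := min_le_left _ _
  have hβ2 : β ≤ κ * ε ^ 2 / 16 := min_le_right _ _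
  refine ⟨β * ε ^ 3 / 6, by positivity, ε ^ 2 / 13, by positivity, ?_⟩
  intro k hk hkn f h0i h01 hsup hij
  have hone : ((1 : Fin (k + 1)) : ℕ) = 1 := by
    rw [Fin.val_one']; exact Nat.mod_eq_of_lt (by omega)
  obtain ⟨u0, hu0⟩ := (f 0).K_nonempty
  have hx : ∃ x : EuclideanSpace ℝ (Fin n), ‖x‖ = 1 ∧ ε < (f 1).toFun x := by
    have hne : ((f 1).toFun '' Metric.sphere (0 : EuclideanSpace ℝ (Fin n)) 1).Nonempty := by
      by_contra hcon
      rw [Set.not_nonempty_iff_eq_empty] at hcon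
      rw [hcon, Real.sSup_empty] at hsup
      linarith
    obtain ⟨_, ⟨x, hx, rfl⟩, hlt⟩ := exists_lt_of_lt_csSup hne hsup
    exact ⟨x, by simpa using hx, hlt⟩
  obtain ⟨x, hx1, hfx⟩ := hx
  obtain ⟨u1, hu1⟩ := (f 1).K_nonempty
  have hu1n : ε < ‖u1‖ := by
    have h1 := (f 1).K_le x u1 hu1
    have h2 := (abs_le.1 (abs_real_inner_le_norm u1 x)).1
    rw [hx1] at h2
    linarith
  obtain ⟨q, q1, q2, q3, q4, q5⟩ := core (ι := {i : Fin (k + 1) // 2 ≤ (i : ℕ)})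
    (fun i => (f i.1).K) (f 0).K u0 u1 ε (β * ε ^ 3 / 6) β hε0 hε1 (by positivity)
    (by field_simp) hβ1 hu0 (f 0).K_norm
    (fun a ha i u hu => ((f 0).K_sprod (f i.1) a ha u hu).trans (h0i i.1 i.2).le)
    (fun a ha => ((f 0).K_sprod (f 1) a ha u1 hu1).trans h01.le)
    ((f 1).K_norm u1 hu1) hu1n
    (fun i => (f i.1).K_nonempty) (fun i => (f i.1).K_norm)
    (fun i u hu => ((f 1).K_sprod (f i.1) u1 hu1 u hu).trans
      (hij 1 i.1 (by omega) (by have := i.2; omega) (by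
        intro h; have h2 := i.2; rw [← h] at h2; omega)).le)
    (fun i j hne u hu v hv => ((f i.1).K_sprod (f j.1) u hu v hv).trans
      (hij i.1 j.1 (by have := i.2; omega) (by have := j.2; omega)
        (fun h => hne (Subtype.ext h))).le)
  have hqpos : 0 < ‖q‖ := lt_of_lt_of_le (by positivity) q1
  have hinv : 0 < ‖q‖⁻¹ := inv_pos.2 hqpos
  refine ⟨‖q‖⁻¹ • q, ?_, ?_, ?_, ?_⟩
  · rw [norm_smul, norm_inv, norm_norm]; field_simp
  · obtain ⟨a, ha, hae⟩ := (f 0).K_att (‖q‖⁻¹ • q)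
    rw [real_inner_smul_right] at hae
    have h1 := q3 a ha
    have h2 : ‖q‖⁻¹ * ⟪a, q⟫_ℝ < κ := by
      rw [inv_mul_lt_iff₀ hqpos]
      nlinarith [mul_pos hκ (pow_pos hε0 2)]
    linarith
  · have h1 := (f 1).K_le (‖q‖⁻¹ • q) u1 hu1
    rw [real_inner_smul_right] at h1
    have h2 : ‖q‖ - β ≤ ‖q‖⁻¹ * ⟪u1, q⟫_ℝ := by
      rw [le_inv_mul_iff₀ hqpos]; nlinarith
    nlinarith [pow_pos hε0 2]
  · intro i hi
    apply le_antisymm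
    · by_contra hcon
      push Not at hcon
      obtain ⟨u, hu, hlt⟩ := q5 ⟨i, hi⟩ (‖q‖ * (f i).toFun (‖q‖⁻¹ • q)) (mul_pos hqpos hcon)
      have h1 := (f i).K_le (‖q‖⁻¹ • q) u hu
      rw [real_inner_smul_right, inv_mul_le_iff₀ hqpos] at h1
      linarith
    · obtain ⟨a, ha, hae⟩ := (f i).K_att (‖q‖⁻¹ • q)
      rw [real_inner_smul_right] at hae
      have h1 := q4 ⟨i, hi⟩ a ha
      have := mul_nonpos_of_nonneg_of_nonpos hinv.le h1
      linarith

end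
end
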